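/- Let I be an ideal of a skew brace B. If B is finitely generated as a skew brace and the quotient skew brace B/I is finitely presented, then I is finitely generated as an ideal of B, i.e. I is the smallest ideal of B containing some finite subset of I. -/

import Mathlib

universe u v

/-- A skew (left) brace: two group structures `(B,+)` and `(B,∘)` on the same set,
sharing the same identity element `zero` (recall that in any skew brace `0 = 1`),
satisfying the skew left distributive law `a ∘ (b + c) = a ∘ b - a + a ∘ c`. -/
structure SkewBrace (B : Type u) where
  add : B → B → B
  zero : B
  neg : B → B
  mul : B → B → B
  inv : B → B
  add_assoc : ∀ a b c, add (add a b) c = add a (add b c)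
  zero_add : ∀ a, add zero a = a
  add_zero : ∀ a, add a zero = a
  neg_add : ∀ a, add (neg a) a = zero
  add_neg : ∀ a, add a (neg a) = zero
  mul_assoc : ∀ a b c, mul (mul a b) c = mul a (mul b c)
  zero_mul : ∀ a, mul zero a = a
  mul_zero : ∀ a, mul a zero = a
  inv_mul : ∀ a, mul (inv a) a = zero
  mul_inv : ∀ a, mul a (inv a) = zero
  compat : ∀ a b c, mul a (add b c) = add (add (mul a b) (neg a)) (mul a c)

namespace SkewBrace

variable {B C Q : Type u}

/-- `λ_a (b) = -a + a ∘ b`. -/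
def lam (S : SkewBrace B) (a b : B) : B := S.add (S.neg a) (S.mul a b)

/-- `a ∗ b = λ_a(b) - b = -a + a ∘ b - b`. -/
def star (S : SkewBrace B) (a b : B) : B := S.add (S.lam a b) (S.neg b)

/-- A sub-skew brace: a subset containing the identity and closed under both group
operations and both inverses. -/
def IsSub (S : SkewBrace B) (T : Set B) : Prop :=
  S.zero ∈ T ∧ (∀ a ∈ T, ∀ b ∈ T, S.add a b ∈ T) ∧ (∀ a ∈ T, S.neg a ∈ T) ∧
    (∀ a ∈ T, ∀ b ∈ T, S.mul a b ∈ T) ∧ (∀ a ∈ T, S.inv a ∈ T)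

/-- The sub-skew brace generated by a subset. -/
def subGen (S : SkewBrace B) (X : Set B) : Set B := ⋂₀ {T | S.IsSub T ∧ X ⊆ T}

/-- A skew brace is finitely generated if a finite subset generates it. -/
def FinitelyGenerated (S : SkewBrace B) : Prop := ∃ T : Finset B, S.subGen ↑T = Set.univ

/-- A subgroup of the additive group `(B,+)`. -/
def IsAddSubgroup (S : SkewBrace B) (T : Set B) : Prop :=
  S.zero ∈ T ∧ (∀ a ∈ T, ∀ b ∈ T, S.add a b ∈ T) ∧ ∀ a ∈ T, S.neg a ∈ T

/-- A subgroup of the multiplicative group `(B,∘)`. -/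
def IsMulSubgroup (S : SkewBrace B) (T : Set B) : Prop :=
  S.zero ∈ T ∧ (∀ a ∈ T, ∀ b ∈ T, S.mul a b ∈ T) ∧ ∀ a ∈ T, S.inv a ∈ T

/-- The additive subgroup generated by a subset. -/
def addClosure (S : SkewBrace B) (X : Set B) : Set B := ⋂₀ {T | S.IsAddSubgroup T ∧ X ⊆ T}

/-- The multiplicative subgroup generated by a subset. -/
def mulClosure (S : SkewBrace B) (X : Set B) : Set B := ⋂₀ {T | S.IsMulSubgroup T ∧ X ⊆ T}

/-- The group `(B,+)` is finitely generated. -/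
def AddFG (S : SkewBrace B) : Prop := ∃ T : Finset B, S.addClosure ↑T = Set.univ

/-- The group `(B,∘)` is finitely generated. -/
def MulFG (S : SkewBrace B) : Prop := ∃ T : Finset B, S.mulClosure ↑T = Set.univ

/-- An ideal of a skew brace: a subgroup of `(B,+)`, normal in `(B,+)` and in `(B,∘)`,
invariant under all the maps `λ_b`. -/
def IsIdeal (S : SkewBrace B) (I : Set B) : Prop :=
  S.IsAddSubgroup I ∧ (∀ b : B, ∀ a ∈ I, S.add (S.add b a) (S.neg b) ∈ I) ∧
    (∀ b : B, ∀ a ∈ I, S.mul (S.mul b a) (S.inv b) ∈ I) ∧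
    ∀ b : B, ∀ a ∈ I, S.lam b a ∈ I

/-- The ideal generated by a subset (the smallest ideal containing it). -/
def idealGen (S : SkewBrace B) (X : Set B) : Set B := ⋂₀ {I | S.IsIdeal I ∧ X ⊆ I}

/-- A homomorphism of skew braces. -/
def IsHom (S : SkewBrace B) (T : SkewBrace C) (f : B → C) : Prop :=
  (∀ a b, f (S.add a b) = T.add (f a) (f b)) ∧ ∀ a b, f (S.mul a b) = T.mul (f a) (f b)

/-- `SF` together with `ι : X → F` is the free skew brace on `X`: every map from `X`
to a skew brace extends uniquely to a homomorphism. -/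
def IsFreeOn {F : Type u} {X : Type v} (SF : SkewBrace F) (ι : X → F) : Prop :=
  ∀ (C : Type u) (SC : SkewBrace C) (f : X → C),
    ∃! g : F → C, IsHom SF SC g ∧ ∀ x, g (ι x) = f x

/-- A skew brace is finitely presented if it is the image of a free skew brace on a
finite set under a homomorphism whose kernel is generated, as an ideal, by finitely
many elements. -/
def FinitelyPresented (S : SkewBrace B) : Prop :=
  ∃ (F : Type u) (SF : SkewBrace F) (m : ℕ) (ι : Fin m → F) (θ : F → B),
    IsFreeOn SF ι ∧ IsHom SF S θ ∧ Function.Surjective θ ∧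
      ∃ R : Finset F, {x | θ x = S.zero} = SF.idealGen ↑R

/-- `π : B → Q` realizes `Q` as the quotient skew brace `B/I`. -/
def IsQuotientBy (S : SkewBrace B) (I : Set B) (SQ : SkewBrace Q) (π : B → Q) : Prop :=
  IsHom S SQ π ∧ Function.Surjective π ∧ {x | π x = SQ.zero} = I

/-- The group `(B,+)` is finitely presented (as an abstract group). -/
def AddFP (S : SkewBrace B) : Prop :=
  ∃ (m : ℕ) (f : FreeGroup (Fin m) → B),
    (∀ x y, f (x * y) = S.add (f x) (f y)) ∧ Function.Surjective f ∧
      ∃ R : Finset (FreeGroup (Fin m)),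
        {x | f x = S.zero} = ↑(Subgroup.normalClosure (R : Set (FreeGroup (Fin m))))

/-- The group `(B,∘)` is finitely presented (as an abstract group). -/
def MulFP (S : SkewBrace B) : Prop :=
  ∃ (m : ℕ) (f : FreeGroup (Fin m) → B),
    (∀ x y, f (x * y) = S.mul (f x) (f y)) ∧ Function.Surjective f ∧
      ∃ R : Finset (FreeGroup (Fin m)),
        {x | f x = S.zero} = ↑(Subgroup.normalClosure (R : Set (FreeGroup (Fin m))))

/-- The ascending chain condition on sub-skew braces. -/
def SubACC (S : SkewBrace B) : Prop :=
  ∀ f : ℕ → Set B, Monotone f → (∀ n, S.IsSub (f n)) → ∃ n, ∀ m, n ≤ m → f m = f n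

/-- The ascending chain condition on subgroups of `(B,+)`. -/
def AddACC (S : SkewBrace B) : Prop :=
  ∀ f : ℕ → Set B, Monotone f → (∀ n, S.IsAddSubgroup (f n)) → ∃ n, ∀ m, n ≤ m → f m = f n

/-- The socle `Soc(B) = Ker(λ) ∩ Z(B,+)`. -/
def soc (S : SkewBrace B) : Set B :=
  {x | (∀ b, S.lam x b = b) ∧ ∀ b, S.add x b = S.add b x}

/-- The centre of the additive group `(B,+)`. -/
def addCenter (S : SkewBrace B) : Set B := {x | ∀ b, S.add x b = S.add b x}

/-- The preimage in `B` of `Ann(B/I)` (for `I` an ideal): the set of `x` such that,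
modulo `I`, `λ_x = id`, `x` is central in `(B,+)` and `x` is central in `(B,∘)`. -/
def annStep (S : SkewBrace B) (I : Set B) : Set B :=
  {x | (∀ b, S.add (S.lam x b) (S.neg b) ∈ I) ∧
       (∀ b, S.add (S.add x b) (S.neg (S.add b x)) ∈ I) ∧
       ∀ b, S.mul (S.mul x b) (S.inv (S.mul b x)) ∈ I}

/-- The preimage in `B` of `Soc(B/I)` (for `I` an ideal). -/
def socStep (S : SkewBrace B) (I : Set B) : Set B :=
  {x | (∀ b, S.add (S.lam x b) (S.neg b) ∈ I) ∧
       ∀ b, S.add (S.add x b) (S.neg (S.add b x)) ∈ I}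

/-- The upper annihilator series `Ann_α(B)`, defined by transfinite recursion. -/
noncomputable def annSeries (S : SkewBrace B) (o : Ordinal.{v}) : Set B :=
  Ordinal.limitRecOn o {S.zero} (fun _ ih => S.annStep ih)
    fun _o _ ih => ⋃ β, ⋃ h : β < _o, ih β h

/-- The upper socle series `Soc_α(B)`, defined by transfinite recursion. -/
noncomputable def socSeries (S : SkewBrace B) (o : Ordinal.{v}) : Set B :=
  Ordinal.limitRecOn o {S.zero} (fun _ ih => S.socStep ih)
    fun _o _ ih => ⋃ β, ⋃ h : β < _o, ih β h

/-- The solution of the YBE associated with a skew brace: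
`r_B(a,b) = (λ_a(b), λ_a(b)⁻¹ ∘ a ∘ b)`. -/
def braceR (S : SkewBrace B) : B × B → B × B :=
  fun p => (S.lam p.1 p.2, S.mul (S.inv (S.lam p.1 p.2)) (S.mul p.1 p.2))

end SkewBrace

/-- The set-theoretic Yang–Baxter (braid) equation
`(r × id)(id × r)(r × id) = (id × r)(r × id)(id × r)`. -/
def ybe {X : Type u} (r : X × X → X × X) : Prop :=
  let r₁ : X × X × X → X × X × X := fun p =>
    ((r (p.1, p.2.1)).1, (r (p.1, p.2.1)).2, p.2.2)
  let r₂ : X × X × X → X × X × X := fun p => (p.1, r p.2)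
  r₁ ∘ r₂ ∘ r₁ = r₂ ∘ r₁ ∘ r₂

/-- A non-degenerate set-theoretic solution: `r` is bijective, satisfies the YBE, and
writing `r (x,y) = (σ_x y, τ_y x)`, all maps `σ_x` and `τ_y` are bijective. -/
def IsNonDegenerateSolution {X : Type u} (r : X × X → X × X) : Prop :=
  Function.Bijective r ∧ ybe r ∧
    (∀ x, Function.Bijective fun y => (r (x, y)).1) ∧
    ∀ y, Function.Bijective fun x => (r (x, y)).2

/-- `S` (with the distinguished map `ι : X → B`) is the structure skew brace of the
solution `(X,r)`: the multiplicative group of `S` is the structure group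
`G(X,r) = ⟨X | x y = σ_x(y) τ_y(x)⟩` (expressed by the relations holding together
with the universal property of the presentation) and `r_S ∘ (ι × ι) = (ι × ι) ∘ r`. -/
def IsStructureSkewBrace {X B : Type u} (r : X × X → X × X)
    (S : SkewBrace B) (ι : X → B) : Prop :=
  (∀ x y, S.mul (ι x) (ι y) = S.mul (ι (r (x, y)).1) (ι (r (x, y)).2)) ∧
  (∀ (H : Type u) [Group H] (f : X → H),
      (∀ x y, f x * f y = f (r (x, y)).1 * f (r (x, y)).2) →
      ∃! φ : B → H, (∀ a b, φ (S.mul a b) = φ a * φ b) ∧ ∀ x, φ (ι x) = f x) ∧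
  ∀ x y, S.braceR (ι x, ι y) = (ι (r (x, y)).1, ι (r (x, y)).2)

namespace SkewBrace

section Basic

variable {B C Q : Type u}

/-- The additive group of a skew brace. -/
abbrev toAddGroup (S : SkewBrace B) : AddGroup B :=
  letI : Zero B := ⟨S.zero⟩
  letI : Add B := ⟨S.add⟩
  { add := S.add, zero := S.zero, neg := S.neg,
    nsmul := nsmulRec, zsmul := @zsmulRec B _ _ ⟨S.neg⟩ nsmulRec, add_assoc := S.add_assoc,
    zero_add := S.zero_add, add_zero := S.add_zero, neg_add_cancel := S.neg_add }

/-- The multiplicative group of a skew brace. -/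
abbrev toGroup (S : SkewBrace B) : Group B :=
  letI : One B := ⟨S.zero⟩
  letI : Mul B := ⟨S.mul⟩
  { mul := S.mul, one := S.zero, inv := S.inv,
    npow := npowRec, zpow := @zpowRec B _ _ ⟨S.inv⟩ npowRec, mul_assoc := S.mul_assoc,
    one_mul := S.zero_mul, mul_one := S.mul_zero, inv_mul_cancel := S.inv_mul }

theorem neg_add_cancel_left (S : SkewBrace B) (a b : B) : S.add (S.neg a) (S.add a b) = b :=
  letI := S.toAddGroup
  _root_.neg_add_cancel_left a b

theorem add_neg_cancel_left (S : SkewBrace B) (a b : B) : S.add a (S.add (S.neg a) b) = b :=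
  letI := S.toAddGroup
  _root_.add_neg_cancel_left a b

theorem inv_mul_cancel_left (S : SkewBrace B) (a b : B) : S.mul (S.inv a) (S.mul a b) = b :=
  letI := S.toGroup
  _root_.inv_mul_cancel_left a b

theorem mul_inv_cancel_left (S : SkewBrace B) (a b : B) : S.mul a (S.mul (S.inv a) b) = b :=
  letI := S.toGroup
  _root_.mul_inv_cancel_left a b

theorem neg_neg (S : SkewBrace B) (a : B) : S.neg (S.neg a) = a :=
  letI := S.toAddGroup
  _root_.neg_neg a

theorem inv_inv (S : SkewBrace B) (a : B) : S.inv (S.inv a) = a :=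
  letI := S.toGroup
  DivisionMonoid.inv_inv a

theorem neg_add_rev (S : SkewBrace B) (a b : B) :
    S.neg (S.add a b) = S.add (S.neg b) (S.neg a) :=
  letI := S.toAddGroup
  SubtractionMonoid.neg_add_rev a b

theorem inv_mul_rev (S : SkewBrace B) (a b : B) :
    S.inv (S.mul a b) = S.mul (S.inv b) (S.inv a) :=
  letI := S.toGroup
  DivisionMonoid.mul_inv_rev a b

theorem mul_eq_add_lam (S : SkewBrace B) (a b : B) : S.mul a b = S.add a (S.lam a b) :=
  (S.add_neg_cancel_left a _).symm

theorem mul_add_eq (S : SkewBrace B) (a b c : B) :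
    S.mul a (S.add b c) = S.add (S.mul a b) (S.lam a c) := by
  rw [S.compat, S.add_assoc]; rfl

theorem lam_inv_lam (S : SkewBrace B) (a b : B) : S.lam a (S.lam (S.inv a) b) = b := by
  have h := S.mul_add_eq a (S.inv a) (S.lam (S.inv a) b)
  rw [← S.mul_eq_add_lam, S.mul_inv_cancel_left, S.mul_inv, S.zero_add] at h
  exact h.symm

theorem add_eq_mul_lam_inv (S : SkewBrace B) (a b : B) :
    S.add a b = S.mul a (S.lam (S.inv a) b) := by
  rw [S.mul_eq_add_lam, S.lam_inv_lam]

section Hom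

variable {S : SkewBrace B} {T : SkewBrace C} {f : B → C}

theorem IsHom.map_zero (hf : IsHom S T f) : f S.zero = T.zero := by
  have h := hf.1 S.zero S.zero
  rw [S.zero_add] at h
  have h' := congrArg (T.add (T.neg (f S.zero))) h
  rw [T.neg_add_cancel_left, T.neg_add] at h'
  exact h'.symm

theorem IsHom.map_neg (hf : IsHom S T f) (a : B) : f (S.neg a) = T.neg (f a) := by
  have h := hf.1 a (S.neg a)
  rw [S.add_neg, hf.map_zero] at h
  have h' := congrArg (T.add (T.neg (f a))) h
  rw [T.neg_add_cancel_left, T.add_zero] at h'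
  exact h'.symm

theorem IsHom.map_inv (hf : IsHom S T f) (a : B) : f (S.inv a) = T.inv (f a) := by
  have h := hf.2 a (S.inv a)
  rw [S.mul_inv, hf.map_zero] at h
  have h' := congrArg (T.mul (T.inv (f a))) h
  rw [T.inv_mul_cancel_left, T.mul_zero] at h'
  exact h'.symm

theorem IsHom.comp {U : SkewBrace Q} {g : C → Q} (hg : IsHom T U g) (hf : IsHom S T f) :
    IsHom S U (g ∘ f) :=
  ⟨fun a b => by simp [hf.1, hg.1], fun a b => by simp [hf.2, hg.2]⟩

theorem IsHom.isIdeal_ker (hf : IsHom S T f) : S.IsIdeal {x | f x = T.zero} := by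
  refine ⟨⟨hf.map_zero, fun a ha b hb => ?_, fun a ha => ?_⟩, fun b a ha => ?_,
    fun b a ha => ?_, fun b a ha => ?_⟩ <;> simp only [Set.mem_ofPred_eq] at *
  · rw [hf.1, ha, hb, T.zero_add]
  · rw [hf.map_neg, ha, ← T.zero_add (T.neg _), T.add_neg]
  · rw [hf.1, hf.1, ha, T.add_zero, hf.map_neg, T.add_neg]
  · rw [hf.2, hf.2, ha, T.mul_zero, hf.map_inv, T.mul_inv]
  · rw [lam, hf.1, hf.2, ha, T.mul_zero, hf.map_neg, T.neg_add]

/-- The elements of `T` congruent to an element of the range of `f` modulo the kernel of `g`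
form a sub-skew brace. -/
theorem IsHom.isSub_preimage_range {U : SkewBrace Q} {g : C → Q} {h : B → Q}
    (hg : IsHom T U g) (hh : IsHom S U h) : T.IsSub {c | ∃ x, g c = h x} := by
  refine ⟨⟨S.zero, by rw [hg.map_zero, hh.map_zero]⟩, ?_, ?_, ?_, ?_⟩
  · rintro a ⟨x, hx⟩ b ⟨y, hy⟩
    exact ⟨S.add x y, by rw [hg.1, hh.1, hx, hy]⟩
  · rintro a ⟨x, hx⟩
    exact ⟨S.neg x, by rw [hg.map_neg, hh.map_neg, hx]⟩
  · rintro a ⟨x, hx⟩ b ⟨y, hy⟩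
    exact ⟨S.mul x y, by rw [hg.2, hh.2, hx, hy]⟩
  · rintro a ⟨x, hx⟩
    exact ⟨S.inv x, by rw [hg.map_inv, hh.map_inv, hx]⟩

theorem IsHom.map_add_neg_eq_zero_iff (hf : IsHom S T f) (a b : B) :
    f (S.add a (S.neg b)) = T.zero ↔ f a = f b := by
  rw [hf.1, hf.map_neg]
  let := T.toAddGroup
  exact add_neg_eq_zero (a := f a) (b := f b)

end Hom

theorem subset_idealGen (S : SkewBrace B) (X : Set B) : X ⊆ S.idealGen X :=
  fun _ hx _ hJ => hJ.2 hx

theorem idealGen_subset {S : SkewBrace B} {X J : Set B} (hJ : S.IsIdeal J) (h : X ⊆ J) :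
    S.idealGen X ⊆ J :=
  fun _ hx => hx J ⟨hJ, h⟩

theorem isIdeal_idealGen (S : SkewBrace B) (X : Set B) : S.IsIdeal (S.idealGen X) :=
  ⟨⟨fun _ hJ => hJ.1.1.1, fun a ha b hb J hJ => hJ.1.1.2.1 a (ha J hJ) b (hb J hJ),
    fun a ha J hJ => hJ.1.1.2.2 a (ha J hJ)⟩,
    fun b a ha J hJ => hJ.1.2.1 b a (ha J hJ),
    fun b a ha J hJ => hJ.1.2.2.1 b a (ha J hJ),
    fun b a ha J hJ => hJ.1.2.2.2 b a (ha J hJ)⟩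

section Quotient

variable {S : SkewBrace B} {I : Set B}

theorem IsIdeal.inv_mem (hI : S.IsIdeal I) {a : B} (ha : a ∈ I) : S.inv a ∈ I := by
  have h := hI.1.2.2 _ (hI.2.2.2 (S.inv a) a ha)
  rwa [lam, S.inv_mul, S.add_zero, S.neg_neg] at h

theorem IsIdeal.neg_conj_mem (hI : S.IsIdeal I) (b : B) {a : B} (ha : a ∈ I) :
    S.add (S.add (S.neg b) a) b ∈ I := by
  have h := hI.2.1 (S.neg b) a ha
  rwa [S.neg_neg] at h

theorem IsIdeal.inv_conj_mem (hI : S.IsIdeal I) (b : B) {a : B} (ha : a ∈ I) :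
    S.mul (S.mul (S.inv b) a) b ∈ I := by
  have h := hI.2.2.1 (S.inv b) a ha
  rwa [S.inv_inv] at h

/-- Congruence modulo an ideal. -/
def IsIdeal.setoid (hI : S.IsIdeal I) : Setoid B where
  r a c := ∃ i ∈ I, c = S.add a i
  iseqv :=
    { refl := fun a => ⟨S.zero, hI.1.1, (S.add_zero a).symm⟩
      symm := by
        rintro a _ ⟨i, hi, rfl⟩
        exact ⟨S.neg i, hI.1.2.2 i hi, by rw [S.add_assoc, S.add_neg, S.add_zero]⟩
      trans := by
        rintro a _ _ ⟨i, hi, rfl⟩ ⟨j, hj, rfl⟩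
        exact ⟨S.add i j, hI.1.2.1 i hi j hj, S.add_assoc a i j⟩ }

theorem IsIdeal.rel_iff_mul (hI : S.IsIdeal I) {a c : B} :
    hI.setoid a c ↔ ∃ i ∈ I, c = S.mul a i := by
  constructor
  · rintro ⟨i, hi, rfl⟩
    exact ⟨_, hI.2.2.2 (S.inv a) i hi, S.add_eq_mul_lam_inv a i⟩
  · rintro ⟨i, hi, rfl⟩
    exact ⟨_, hI.2.2.2 a i hi, S.mul_eq_add_lam a i⟩

theorem IsIdeal.rel_add (hI : S.IsIdeal I) {a a' b b' : B} (ha : hI.setoid a a')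
    (hb : hI.setoid b b') : hI.setoid (S.add a b) (S.add a' b') := by
  obtain ⟨i, hi, rfl⟩ := ha
  obtain ⟨j, hj, rfl⟩ := hb
  refine ⟨_, hI.1.2.1 _ (hI.neg_conj_mem b hi) j hj, ?_⟩
  simp only [S.add_assoc, S.add_neg_cancel_left]

theorem IsIdeal.rel_mul (hI : S.IsIdeal I) {a a' b b' : B} (ha : hI.setoid a a')
    (hb : hI.setoid b b') : hI.setoid (S.mul a b) (S.mul a' b') := by
  obtain ⟨i, hi, rfl⟩ := hI.rel_iff_mul.1 ha
  refine hI.setoid.trans (hI.rel_iff_mul.2 ⟨_, hI.inv_conj_mem b hi, rfl⟩) ?_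
  obtain ⟨j, hj, rfl⟩ := hb
  refine ⟨_, hI.2.2.2 (S.mul a i) j hj, ?_⟩
  rw [S.mul_add_eq]
  simp only [S.mul_assoc, S.mul_inv_cancel_left]

theorem IsIdeal.rel_neg (hI : S.IsIdeal I) {a a' : B} (ha : hI.setoid a a') :
    hI.setoid (S.neg a) (S.neg a') := by
  obtain ⟨i, hi, rfl⟩ := ha
  refine ⟨_, hI.2.1 a _ (hI.1.2.2 i hi), ?_⟩
  simp only [S.neg_add_rev, S.add_assoc, S.neg_add_cancel_left]

theorem IsIdeal.rel_inv (hI : S.IsIdeal I) {a a' : B} (ha : hI.setoid a a') :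
    hI.setoid (S.inv a) (S.inv a') := by
  obtain ⟨i, hi, rfl⟩ := hI.rel_iff_mul.1 ha
  refine hI.rel_iff_mul.2 ⟨_, hI.2.2.1 a _ (hI.inv_mem hi), ?_⟩
  simp only [S.inv_mul_rev, S.mul_assoc, S.inv_mul_cancel_left]

/-- The quotient of a skew brace by an ideal. -/
def IsIdeal.quotient (hI : S.IsIdeal I) : SkewBrace (Quotient hI.setoid) where
  add := Quotient.map₂ S.add fun _ _ ha _ _ hb => hI.rel_add ha hb
  zero := Quotient.mk _ S.zero
  neg := Quotient.map S.neg fun _ _ ha => hI.rel_neg ha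
  mul := Quotient.map₂ S.mul fun _ _ ha _ _ hb => hI.rel_mul ha hb
  inv := Quotient.map S.inv fun _ _ ha => hI.rel_inv ha
  add_assoc := by
    rintro ⟨a⟩ ⟨b⟩ ⟨c⟩
    exact congrArg (Quotient.mk _) (S.add_assoc a b c)
  zero_add := by
    rintro ⟨a⟩
    exact congrArg (Quotient.mk _) (S.zero_add a)
  add_zero := by
    rintro ⟨a⟩
    exact congrArg (Quotient.mk _) (S.add_zero a)
  neg_add := by
    rintro ⟨a⟩
    exact congrArg (Quotient.mk _) (S.neg_add a)
  add_neg := by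
    rintro ⟨a⟩
    exact congrArg (Quotient.mk _) (S.add_neg a)
  mul_assoc := by
    rintro ⟨a⟩ ⟨b⟩ ⟨c⟩
    exact congrArg (Quotient.mk _) (S.mul_assoc a b c)
  zero_mul := by
    rintro ⟨a⟩
    exact congrArg (Quotient.mk _) (S.zero_mul a)
  mul_zero := by
    rintro ⟨a⟩
    exact congrArg (Quotient.mk _) (S.mul_zero a)
  inv_mul := by
    rintro ⟨a⟩
    exact congrArg (Quotient.mk _) (S.inv_mul a)
  mul_inv := by
    rintro ⟨a⟩
    exact congrArg (Quotient.mk _) (S.mul_inv a)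
  compat := by
    rintro ⟨a⟩ ⟨b⟩ ⟨c⟩
    exact congrArg (Quotient.mk _) (S.compat a b c)

theorem IsIdeal.isQuotientBy (hI : S.IsIdeal I) :
    S.IsQuotientBy I hI.quotient (Quotient.mk hI.setoid) := by
  refine ⟨⟨fun _ _ => rfl, fun _ _ => rfl⟩, Quotient.mk_surjective, ?_⟩
  ext x
  constructor
  · intro h
    obtain ⟨i, hi, rfl⟩ := Quotient.exact (show Quotient.mk hI.setoid S.zero = _ from h.symm)
    rwa [S.zero_add]
  · intro h
    exact Eq.symm (Quotient.sound ⟨x, h, (S.zero_add x).symm⟩)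

end Quotient

end Basic

end SkewBrace

/-- **Lemma 1.** Let `I` be an ideal of a skew brace `B`. If `B` is finitely generated
as a skew brace and the quotient skew brace `B/I` is finitely presented, then `I` is
finitely generated as an ideal of `B`, i.e. `I` is the smallest ideal of `B`
containing some finite subset of `I`. -/
theorem ideal_fg_of_fg_of_quotient_fp {B : Type u} (S : SkewBrace B) (I : Set B)
    (hI : S.IsIdeal I) (hfg : S.FinitelyGenerated)
    (hfp : ∀ (Q : Type u) (SQ : SkewBrace Q) (π : B → Q),
      S.IsQuotientBy I SQ π → SQ.FinitelyPresented) :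
    ∃ T : Finset B, ↑T ⊆ I ∧ S.idealGen ↑T = I := by
  classical
  obtain ⟨hπ, hπs, hπk⟩ := hI.isQuotientBy
  obtain ⟨F, SF, m, ι, θ, hfree, hθ, hθs, R, hR⟩ := hfp _ _ _ hI.isQuotientBy
  set π : B → Quotient hI.setoid := Quotient.mk hI.setoid
  obtain ⟨X, hX⟩ := hfg
  choose b hb using fun i => hπs (θ (ι i))
  obtain ⟨g, ⟨hg, hgι⟩, -⟩ := hfree B S b
  have hπg : π ∘ g = θ := (hfree _ hI.quotient (θ ∘ ι)).unique
    ⟨hπ.comp hg, fun i => by simp [hgι, hb]⟩ ⟨hθ, fun _ => rfl⟩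
  have hπg' (x : F) : π (g x) = θ x := congrFun hπg x
  choose s hs using fun x => hθs (π x)
  have memI (x : B) : x ∈ I ↔ π x = hI.quotient.zero :=
    (Set.ext_iff.1 hπk x).symm
  let T : Finset B := R.image g ∪ X.image fun x => S.add x (S.neg (g (s x)))
  have hTI : (T : Set B) ⊆ I := by
    intro t ht
    rw [memI]
    rcases Finset.mem_union.1 (Finset.mem_coe.1 ht) with h | h
    · obtain ⟨r, hr, rfl⟩ := Finset.mem_image.1 h
      rw [hπg']
      exact hR.ge (SF.subset_idealGen _ hr)
    · obtain ⟨x, -, rfl⟩ := Finset.mem_image.1 h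
      rw [hπ.map_add_neg_eq_zero_iff, hπg', hs]
  refine ⟨T, hTI, (SkewBrace.idealGen_subset hI hTI).antisymm fun y hy => ?_⟩
  have hJ := S.isIdeal_idealGen (T : Set B)
  have hTJ := S.subset_idealGen (T : Set B)
  obtain ⟨hρ, -, hρk⟩ := hJ.isQuotientBy
  set ρ : B → Quotient hJ.setoid := Quotient.mk hJ.setoid
  have memJ (x : B) : x ∈ S.idealGen (T : Set B) ↔ ρ x = hJ.quotient.zero :=
    (Set.ext_iff.1 hρk x).symm
  have hgen : y ∈ S.subGen (X : Set B) := hX ▸ Set.mem_univ y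
  obtain ⟨x, hx⟩ := hgen _ ⟨hρ.isSub_preimage_range (hρ.comp hg), fun x hx =>
    ⟨s x, (hρ.map_add_neg_eq_zero_iff _ _).1 ((memJ _).1 (hTJ (Finset.mem_coe.2
      (Finset.mem_union_right _ (Finset.mem_image_of_mem _ hx)))))⟩⟩
  have hyx : π y = π (g x) := by
    rw [← hπ.map_add_neg_eq_zero_iff, ← memI]
    exact SkewBrace.idealGen_subset hI hTI ((memJ _).2 ((hρ.map_add_neg_eq_zero_iff _ _).2 hx))
  have hxR : x ∈ SF.idealGen (R : Set F) :=
    hR.le (show θ x = _ by rw [← hπg', ← hyx, (memI y).1 hy])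
  have hxJ := SkewBrace.idealGen_subset (hρ.comp hg).isIdeal_ker (fun r hr => (memJ _).1
    (hTJ (Finset.mem_coe.2 (Finset.mem_union_left _ (Finset.mem_image_of_mem _ hr))))) hxR
  exact (memJ y).2 (hx.trans hxJ)
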